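/- arXiv:1701.08538 — 3 statements merged into one kernel-verified Lean document; each statement's English description precedes it below -/
import Mathlib

section
/- For every finite digraph D (loops allowed), the intersection number of the middle digraph is at least that of the subdivision digraph: i(M(D)) ≥ i(S(D)). -/
/-- The type of arcs of a digraph given by a relation `E` on `V`. -/
abbrev Arc (V : Type) (E : V → V → Prop) : Type := {p : V × V // E p.1 p.2}

/-- A sink: a vertex with no outgoing arcs. -/
def IsSink {V : Type} (E : V → V → Prop) (x : V) : Prop := ∀ y, ¬ E x y

/-- A source: a vertex with no incoming arcs. -/
def IsSource {V : Type} (E : V → V → Prop) (x : V) : Prop := ∀ y, ¬ E y x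

/-- The Heuchenne condition. -/
def Heuchenne {V : Type} (E : V → V → Prop) : Prop :=
  ∀ u v w x : V, E v w → E u w → E u x → E v x

/-- The intersection number of a digraph: the least `n` such that the digraph has an
intersection representation by ordered pairs of subsets of a set with `n` elements. -/
noncomputable def iNum {V : Type} (E : V → V → Prop) : ℕ :=
  sInf {n : ℕ | ∃ S T : V → Set (Fin n), ∀ x y : V, E x y ↔ (S x ∩ T y).Nonempty}

/-- The arc relation of the subdivision digraph `S(D)` on `V ⊕ Arc V E`. -/
def SArc {V : Type} (E : V → V → Prop) : V ⊕ Arc V E → V ⊕ Arc V E → Prop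
  | Sum.inl u, Sum.inr e => e.val.1 = u
  | Sum.inr e, Sum.inl w => e.val.2 = w
  | _, _ => False

/-- The arc relation of the middle digraph `M(D)`: arcs of `S(D)` together with the
arcs of the line digraph between arc-vertices. -/
def MArc {V : Type} (E : V → V → Prop) : V ⊕ Arc V E → V ⊕ Arc V E → Prop
  | Sum.inr e, Sum.inr f => e.val.2 = f.val.1
  | a, b => SArc E a b

/-- The arc relation of `N(D)`: arcs of `S(D)` together with the arcs of `D` between
vertex-vertices. -/
def NArc {V : Type} (E : V → V → Prop) : V ⊕ Arc V E → V ⊕ Arc V E → Prop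
  | Sum.inl u, Sum.inl w => E u w
  | a, b => SArc E a b

/-- The arc relation of the total digraph `T(D)`. -/
def TArc {V : Type} (E : V → V → Prop) : V ⊕ Arc V E → V ⊕ Arc V E → Prop
  | Sum.inl u, Sum.inl w => E u w
  | Sum.inl u, Sum.inr e => e.val.1 = u
  | Sum.inr e, Sum.inl w => e.val.2 = w
  | Sum.inr e, Sum.inr f => e.val.2 = f.val.1

/-- The arc relation of `T⁻(D)`: the total digraph with the loops at arc-vertices deleted. -/
def TMinusArc {V : Type} (E : V → V → Prop) (a b : V ⊕ Arc V E) : Prop :=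
  TArc E a b ∧ ∀ e : Arc V E, ¬ (a = Sum.inr e ∧ b = Sum.inr e)

/-- `F` is a cover of the digraph `E` by generalized complete bipartite subdigraphs. -/
def IsGBSCover {V : Type} (E : V → V → Prop) (F : Finset (Set V × Set V)) : Prop :=
  (∀ p ∈ F, ∀ x ∈ p.1, ∀ y ∈ p.2, E x y) ∧
  (∀ x y : V, E x y → ∃ p ∈ F, x ∈ p.1 ∧ y ∈ p.2)

/-- The minimum number of GBSs needed to cover the arcs of the digraph `E`. -/
noncomputable def gbsNum {V : Type} (E : V → V → Prop) : ℕ :=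
  sInf {k : ℕ | ∃ F : Finset (Set V × Set V), F.card = k ∧ IsGBSCover E F}

/-- The loops of `D` touch (other than themselves) only sinks and sources. -/
def LoopsTouchOnlySinksSources {V : Type} (E : V → V → Prop) : Prop :=
  ∀ l : V, E l l → ∀ w : V, w ≠ l → (E w l ∨ E l w) → IsSink E w ∨ IsSource E w

/-- Every relation on a finite type has an intersection representation. -/
theorem iNum_set_nonempty {W : Type} [Finite W] (R : W → W → Prop) :
    {n : ℕ | ∃ S T : W → Set (Fin n), ∀ x y : W, R x y ↔ (S x ∩ T y).Nonempty}.Nonempty := by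
  obtain ⟨n, ⟨g⟩⟩ := Finite.exists_equiv_fin W
  refine ⟨n, fun x => {g x}, fun y => {c | R (g.symm c) y}, fun x y => ?_⟩
  constructor
  · intro h
    exact ⟨g x, rfl, by simpa using h⟩
  · rintro ⟨c, hc, hr⟩
    have hc' : c = g x := hc
    subst hc'
    simpa using hr

/-- `i(M(D)) ≥ i(S(D))`. -/
theorem iNum_middle_ge_iNum_subdivision
    (V : Type) [Fintype V] (E : V → V → Prop) :
    iNum (MArc E) ≥ iNum (SArc E) := by
  obtain ⟨S, T, h⟩ := Nat.sInf_mem (iNum_set_nonempty (MArc E))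
  refine Nat.sInf_le ⟨
    fun a => {c | c ∈ S a ∧ ∀ e, a = Sum.inr e → ∃ w, c ∈ T (Sum.inl w)},
    fun b => {c | c ∈ T b ∧ ∀ f, b = Sum.inr f → ∃ u, c ∈ S (Sum.inl u)}, ?_⟩
  have key : ∀ u w c, c ∈ S (Sum.inl u) → c ∈ T (Sum.inl w) → False :=
    fun u w c hu hw => (h (Sum.inl u) (Sum.inl w)).2 ⟨c, hu, hw⟩
  rintro (u | e) (w | f)
  · exact ⟨fun hf => hf.elim, fun ⟨c, hc, hd⟩ => key _ _ c hc.1 hd.1⟩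
  · refine ⟨fun hs => ?_, fun ⟨c, hc, hd⟩ => (h (Sum.inl u) (Sum.inr f)).2 ⟨c, hc.1, hd.1⟩⟩
    obtain ⟨c, hc, hd⟩ := (h (Sum.inl u) (Sum.inr f)).1 hs
    exact ⟨c, ⟨hc, fun e he => by cases he⟩, ⟨hd, fun _ _ => ⟨u, hc⟩⟩⟩
  · refine ⟨fun hs => ?_, fun ⟨c, hc, hd⟩ => (h (Sum.inr e) (Sum.inl w)).2 ⟨c, hc.1, hd.1⟩⟩
    obtain ⟨c, hc, hd⟩ := (h (Sum.inr e) (Sum.inl w)).1 hs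
    exact ⟨c, ⟨hc, fun _ _ => ⟨w, hd⟩⟩, ⟨hd, fun e he => by cases he⟩⟩
  · refine ⟨fun hf => hf.elim, ?_⟩
    rintro ⟨c, ⟨_, hc⟩, ⟨_, hd⟩⟩
    obtain ⟨w, hw⟩ := hc e rfl
    obtain ⟨u, hu⟩ := hd f rfl
    exact (key u w c hu hw).elim
end

section
/- Let D be a finite digraph (no multiple arcs) whose loops touch only themselves, sinks and sources. Then the intersection number of T^-(D) is at least that of the subdivision digraph: i(T^-(D)) ≥ i(S(D)). -/
/-- Every relation on a finite type has a finite intersection representation. -/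
theorem exists_rep {W : Type} [Finite W] (R : W → W → Prop) :
    ∃ n : ℕ, ∃ S T : W → Set (Fin n), ∀ x y : W, R x y ↔ (S x ∩ T y).Nonempty := by
  obtain ⟨n, ⟨φ⟩⟩ := Finite.exists_equiv_fin (W × W)
  refine ⟨n, fun x => {i | (φ.symm i).1 = x ∧ R (φ.symm i).1 (φ.symm i).2},
    fun y => {i | (φ.symm i).2 = y}, fun x y => ⟨fun h => ⟨φ (x, y), ?_⟩, ?_⟩⟩
  · simpa using h
  · rintro ⟨i, ⟨rfl, h⟩, rfl⟩
    exact h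

/-- `i(T⁻(D)) ≥ i(S(D))` when the loops of `D` touch only themselves,
sinks and sources. -/
theorem iNum_Tminus_ge_iNum_subdivision
    (V : Type) [Fintype V] (E : V → V → Prop)
    (hloops : LoopsTouchOnlySinksSources E) :
    iNum (TMinusArc E) ≥ iNum (SArc E) := by
  suffices key : ∀ n : ℕ, (∃ S T : V ⊕ Arc V E → Set (Fin n),
      ∀ x y, TMinusArc E x y ↔ (S x ∩ T y).Nonempty) →
      ∃ S T : V ⊕ Arc V E → Set (Fin n), ∀ x y, SArc E x y ↔ (S x ∩ T y).Nonempty from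
    Nat.sInf_le (key _ (Nat.sInf_mem (exists_rep (TMinusArc E))))
  rintro n ⟨S, T, hST⟩
  have hmk : ∀ {x y i}, i ∈ S x → i ∈ T y → TMinusArc E x y :=
    fun hx hy => (hST _ _).2 ⟨_, hx, hy⟩
  -- for a non-sink pick an outgoing arc, the loop if there is one
  have hg : ∀ u, (∃ y, E u y) → ∃ i : Fin n, i ∈ S (Sum.inl u) ∧
      ∃ e : Arc V E, e.val.1 = u ∧ (E u u → e.val.2 = u) ∧ i ∈ T (Sum.inr e) := by
    intro u hu
    have h1 : ∃ e : Arc V E, e.val.1 = u ∧ (E u u → e.val.2 = u) := by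
      by_cases h : E u u
      · exact ⟨⟨(u, u), h⟩, rfl, fun _ => rfl⟩
      · obtain ⟨y, hy⟩ := hu
        exact ⟨⟨(u, y), hy⟩, rfl, fun h' => absurd h' h⟩
    obtain ⟨e, he, hl⟩ := h1
    obtain ⟨i, hi, hi'⟩ := (hST (Sum.inl u) (Sum.inr e)).1 ⟨he, by simp⟩
    exact ⟨i, hi, e, he, hl, hi'⟩
  have hh : ∀ w, (∃ y, E y w) → ∃ i : Fin n, i ∈ T (Sum.inl w) ∧
      ∃ e : Arc V E, e.val.2 = w ∧ (E w w → e.val.1 = w) ∧ i ∈ S (Sum.inr e) := by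
    intro w hw
    have h1 : ∃ e : Arc V E, e.val.2 = w ∧ (E w w → e.val.1 = w) := by
      by_cases h : E w w
      · exact ⟨⟨(w, w), h⟩, rfl, fun _ => rfl⟩
      · obtain ⟨y, hy⟩ := hw
        exact ⟨⟨(y, w), hy⟩, rfl, fun h' => absurd h' h⟩
    obtain ⟨e, he, hl⟩ := h1
    obtain ⟨i, hi, hi'⟩ := (hST (Sum.inr e) (Sum.inl w)).1 ⟨he, by simp⟩
    exact ⟨i, hi', e, he, hl, hi⟩
  choose g hgS eg hg1 hgl hgT using hg
  choose h hhT eh hh2 hhl hhS using hh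
  have ginj : ∀ u hu u' hu', g u hu = g u' hu' → u = u' := by
    intro u hu u' hu' heq
    have h1 := (hmk (hgS u hu) (heq ▸ hgT u' hu')).1
    exact (h1 : (eg u' hu').val.1 = u).symm.trans (hg1 u' hu')
  have hinj : ∀ w hw w' hw', h w hw = h w' hw' → w = w' := by
    intro w hw w' hw' heq
    have h1 := (hmk (hhS w hw) (heq ▸ hhT w' hw')).1
    exact (hh2 w hw).symm.trans (h1 : (eh w hw).val.2 = w')
  have gh : ∀ u hu w hw, g u hu ≠ h w hw := by
    intro u hu w hw heq
    have h0 : TMinusArc E (Sum.inl u) (Sum.inl w) := hmk (hgS u hu) (heq ▸ hhT w hw)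
    have h1 : E u w := h0.1
    have h2 : TMinusArc E (Sum.inr (eh w hw)) (Sum.inr (eg u hu)) :=
      hmk (hhS w hw) (heq ▸ hgT u hu)
    have h3 : (eh w hw).val.2 = (eg u hu).val.1 := h2.1
    have h4 : w = u := (hh2 w hw).symm.trans (h3.trans (hg1 u hu))
    subst h4
    have h5 : eh w hw = eg w hu := by
      apply Subtype.ext
      apply Prod.ext
      · rw [hhl w hw h1, hg1]
      · rw [hh2, hgl w hu h1]
    exact h2.2 (eh w hw) ⟨rfl, by rw [h5]⟩
  refine ⟨fun x => Sum.elim (fun u => {i | ∃ hu, i = g u hu})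
      (fun e => {h e.val.2 ⟨_, e.property⟩}) x,
    fun x => Sum.elim (fun w => {i | ∃ hw, i = h w hw})
      (fun e => {g e.val.1 ⟨_, e.property⟩}) x, ?_⟩
  rintro (u | e) (w | f)
  · refine ⟨fun hF => hF.elim, ?_⟩
    rintro ⟨i, ⟨hu, h1⟩, ⟨hw, h2⟩⟩
    exact (gh u hu w hw (h1.symm.trans h2)).elim
  · constructor
    · intro hs
      have hs : f.val.1 = u := hs
      subst hs
      exact ⟨_, ⟨⟨_, f.property⟩, rfl⟩, rfl⟩
    · rintro ⟨i, ⟨hu, h1⟩, h2⟩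
      exact ginj _ _ _ _ ((h2 : i = _).symm.trans h1)
  · constructor
    · intro hs
      have hs : e.val.2 = w := hs
      subst hs
      exact ⟨_, rfl, ⟨⟨_, e.property⟩, rfl⟩⟩
    · rintro ⟨i, h1, ⟨hw, h2⟩⟩
      exact hinj _ _ _ _ ((h1 : i = _).symm.trans h2)
  · refine ⟨fun hF => hF.elim, ?_⟩
    rintro ⟨i, h1, h2⟩
    exact (gh _ _ _ _ ((h2 : i = _).symm.trans (h1 : i = _))).elim
end

section
/- Let D be a finite digraph (no multiple arcs) whose loops touch only themselves, sinks and sources. Then i(T^-(D)) ≤ 2v − A − B, where v is the number of vertices of D, A the number of sinks of D and B the number of sources of D. -/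
/-- Out-sets of the representation. -/
def repS {V : Type} (E : V → V → Prop) :
    V ⊕ Arc V E → Set ({x : V // ¬ IsSource E x} ⊕ {x : V // ¬ IsSink E x})
  | Sum.inl u => {i | match i with
      | Sum.inl x => IsSink E x.1 ∧ E u x.1
      | Sum.inr x => u = x.1}
  | Sum.inr e => {i | match i with
      | Sum.inl x => e.1.2 = x.1
      | Sum.inr x => E x.1 x.1 ∧ e.1.2 = x.1 ∧ e.1.1 ≠ x.1}

/-- In-sets of the representation. -/
def repT {V : Type} (E : V → V → Prop) :
    V ⊕ Arc V E → Set ({x : V // ¬ IsSource E x} ⊕ {x : V // ¬ IsSink E x})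
  | Sum.inl w => {i | match i with
      | Sum.inl x => w = x.1
      | Sum.inr x => E x.1 w ∧ (E x.1 x.1 → w = x.1)}
  | Sum.inr f => {i | match i with
      | Sum.inl x => f.1.1 = x.1 ∧ f.1.2 ≠ x.1
      | Sum.inr x => f.1.1 = x.1}

theorem rep_spec {V : Type} (E : V → V → Prop) (h : LoopsTouchOnlySinksSources E)
    (a b : V ⊕ Arc V E) : TMinusArc E a b ↔ (repS E a ∩ repT E b).Nonempty := by
  have nsrc : ∀ {u w}, E u w → ¬ IsSource E w := fun {u w} huw hs => hs u huw
  have nsnk : ∀ {u w}, E u w → ¬ IsSink E u := fun {u w} huw hs => hs w huw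
  constructor
  · rintro ⟨hT, hne⟩
    rcases a with u | ⟨⟨e1, e2⟩, he⟩ <;> rcases b with w | ⟨⟨f1, f2⟩, hf⟩ <;>
      simp only [TArc] at hT <;> (try simp only at he) <;> (try simp only at hf)
    · by_cases hl : E u u ∧ w ≠ u
      · refine ⟨Sum.inl ⟨w, nsrc hT⟩, ⟨?_, hT⟩, rfl⟩
        exact (h u hl.1 w hl.2 (Or.inr hT)).resolve_right (nsrc hT)
      · exact ⟨Sum.inr ⟨u, nsnk hT⟩, rfl, hT, fun hu => by_contra fun hw => hl ⟨hu, hw⟩⟩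
    · subst hT
      exact ⟨Sum.inr ⟨f1, nsnk hf⟩, rfl, rfl⟩
    · subst hT
      exact ⟨Sum.inl ⟨e2, nsrc he⟩, rfl, rfl⟩
    · subst hT
      by_cases hl : f2 = e2
      · subst hl
        refine ⟨Sum.inr ⟨f2, nsnk hf⟩, ⟨hf, rfl, ?_⟩, rfl⟩
        intro hc
        simp only at hc
        subst hc
        exact hne ⟨(e1, e1), he⟩ ⟨rfl, rfl⟩
      · exact ⟨Sum.inl ⟨e2, nsrc he⟩, rfl, rfl, hl⟩
  · rintro ⟨i, hS, hT⟩
    rcases a with u | ⟨⟨e1, e2⟩, he⟩ <;> rcases b with w | ⟨⟨f1, f2⟩, hf⟩ <;>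
      rcases i with ⟨x, hx⟩ | ⟨x, hx⟩ <;>
      simp only [repS, repT, Set.mem_ofPred_eq] at hS hT <;>
      simp only [TMinusArc, TArc] <;> grind [IsSink]

/-- `i(T⁻(D)) ≤ 2v - A - B` when the loops of `D` touch only themselves,
sinks and sources. -/
theorem iNum_Tminus_le
    (V : Type) [Fintype V] (E : V → V → Prop)
    (hloops : LoopsTouchOnlySinksSources E) :
    iNum (TMinusArc E) ≤
      2 * Nat.card V - Nat.card {x : V // IsSink E x} - Nat.card {x : V // IsSource E x} := by
  classical
  let U := {x : V // ¬ IsSource E x} ⊕ {x : V // ¬ IsSink E x}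
  have hcard : Nat.card U = 2 * Nat.card V - Nat.card {x : V // IsSink E x}
      - Nat.card {x : V // IsSource E x} := by
    have h1 := Fintype.card_subtype_compl (IsSink E)
    have h2 := Fintype.card_subtype_compl (IsSource E)
    have h3 := Fintype.card_subtype_le (IsSink E)
    have h4 := Fintype.card_subtype_le (IsSource E)
    simp only [U, Nat.card_eq_fintype_card, Fintype.card_sum]
    omega
  rw [← hcard]
  apply Nat.sInf_le
  let φ : U ≃ Fin (Nat.card U) := Finite.equivFin U
  refine ⟨fun a => Set.image φ (repS E a), fun a => Set.image φ (repT E a), fun a b => ?_⟩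
  rw [rep_spec E hloops, ← Set.image_inter φ.injective, Set.image_nonempty]
end
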